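/- For every 2-connected graph F and every positive integer k, there exists an F-WORM colorable graph G with W^-(G,F) = k. -/

import Mathlib

open SimpleGraph

/-- A vertex coloring `c` of `G` is an `F`-WORM coloring if no subgraph of `G`
isomorphic to `F` is monochromatic or rainbow. -/
def IsFWORM {α β : Type*} (F : SimpleGraph α) (G : SimpleGraph β) (c : β → ℕ) : Prop :=
  ∀ f : F →g G, Function.Injective f →
    (∃ u v : α, c (f u) ≠ c (f v)) ∧ (∃ u v : α, u ≠ v ∧ c (f u) = c (f v))

/-- `G` is `F`-WORM colorable if it admits an `F`-WORM coloring. -/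
def FWORMColorable {α β : Type*} (F : SimpleGraph α) (G : SimpleGraph β) : Prop :=
  ∃ c : β → ℕ, IsFWORM F G c

/-- `W^-(G,F)`: the minimum number of colors used in an `F`-WORM coloring of `G`. -/
noncomputable def wormLower {α β : Type*} (F : SimpleGraph α) (G : SimpleGraph β) : ℕ :=
  sInf {k | ∃ c : β → ℕ, IsFWORM F G c ∧ (Set.range c).ncard = k}

/-- `F` is 2-connected: it has at least 3 vertices, is connected, and removing
any single vertex leaves it connected. -/
def TwoConnected {α : Type*} [Fintype α] (F : SimpleGraph α) : Prop :=
  3 ≤ Fintype.card α ∧ F.Connected ∧ ∀ v : α, (F.induce {v}ᶜ).Connected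

/-- A family of finite sets is `l`-sparse if every nonempty subfamily of at most `l` members is
a hyperforest, i.e. has no Berge cycle. -/
def SparseFamily {ι V : Type*} [DecidableEq V] (l : ℕ) (e : ι → Finset V) : Prop :=
  ∀ S : Finset ι, S.Nonempty → S.card ≤ l → ∑ s ∈ S, (e s).card + 1 ≤ (S.biUnion e).card + S.card

theorem SparseFamily.of_subset {ι V : Type*} [DecidableEq V] {l : ℕ} {e : ι → Finset V}
    (he : SparseFamily l e) {S : Finset ι} (hS : S.Nonempty) (hl : S.card ≤ l)
    {A : ι → Finset V} (hA : ∀ s ∈ S, A s ⊆ e s) :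
    ∑ s ∈ S, (A s).card + 1 ≤ (S.biUnion A).card + S.card := by
  have h1 := he S hS hl
  have h2 : S.biUnion e ⊆ S.biUnion A ∪ S.biUnion (fun s => e s \ A s) := by
    intro v hv
    simp only [Finset.mem_biUnion, Finset.mem_union, Finset.mem_sdiff] at hv ⊢
    obtain ⟨s, hs, hv⟩ := hv
    by_cases h : v ∈ A s
    · exact Or.inl ⟨s, hs, h⟩
    · exact Or.inr ⟨s, hs, hv, h⟩
  have h3 := (Finset.card_le_card h2).trans (Finset.card_union_le _ _)
  have h4 : (S.biUnion (fun s => e s \ A s)).card ≤ ∑ s ∈ S, (e s \ A s).card :=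
    Finset.card_biUnion_le
  have h5 : ∑ s ∈ S, (e s).card = ∑ s ∈ S, (e s \ A s).card + ∑ s ∈ S, (A s).card := by
    rw [← Finset.sum_add_distrib]
    exact Finset.sum_congr rfl fun s hs => (Finset.card_sdiff_add_card_eq_card (hA s hs)).symm
  omega

/-- The embedding of the `h`-th copy of a partite system into its amalgamation along part `i`. -/
def amalgamEmb {V W κ Q : Type*} [DecidableEq Q] (π : V → Q) (i : Q) (g : κ → V → W) (h : κ)
    (v : V) : W ⊕ (κ × V) :=
  if π v = i then Sum.inl (g h v) else Sum.inr (h, v)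

theorem amalgamEmb_injective {V W κ Q : Type*} [DecidableEq Q] {π : V → Q} {i : Q}
    {g : κ → V → W} (hg : ∀ h, Set.InjOn (g h) {v | π v = i}) (h : κ) :
    Function.Injective (amalgamEmb π i g h) := by
  intro v w hvw
  unfold amalgamEmb at hvw
  split_ifs at hvw with hv hw hw
  · exact hg h hv hw (Sum.inl.inj hvw)
  · exact (Prod.ext_iff.1 (Sum.inr.inj hvw)).2

theorem SparseFamily.amalgam {V W κ ι Q : Type*} [DecidableEq V] [DecidableEq W]
    [DecidableEq κ] [DecidableEq ι] [DecidableEq Q] {l : ℕ}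
    {e : ι → Finset V} {π : V → Q} {i : Q} {f : κ → Finset W} {g : κ → V → W}
    (hg : ∀ h, Set.InjOn (g h) {v | π v = i}) (hgf : ∀ h v, π v = i → g h v ∈ f h)
    (hπ : ∀ s, Set.InjOn π (e s)) (he : SparseFamily (l + 1) e) (hf : SparseFamily l f) :
    SparseFamily (l + 1) (fun p : κ × ι => (e p.2).image (amalgamEmb π i g p.1)) := by
  intro S
  induction S using Finset.strongInduction with
  | H S ih =>
  intro hS hl
  have hinj := amalgamEmb_injective hg
  by_cases hA : ∃ p ∈ S, ∀ q ∈ S, q.1 = p.1 → q = p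
  · obtain ⟨p, hp, hpu⟩ := hA
    set E : κ × ι → Finset (W ⊕ (κ × V)) := fun p => (e p.2).image (amalgamEmb π i g p.1) with hE
    rcases (S.erase p).eq_empty_or_nonempty with h0 | h0
    · have : S = {p} := by
        rw [← Finset.insert_erase hp, h0]; rfl
      subst this
      simp
    · have h1 := ih (S.erase p) (Finset.erase_ssubset hp) h0
        ((Finset.card_le_card (Finset.erase_subset _ _)).trans hl)
      have hu : S.biUnion E = E p ∪ (S.erase p).biUnion E := by
        conv_lhs => rw [← Finset.insert_erase hp]
        rw [Finset.biUnion_insert]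
      have h2 := Finset.card_union_add_card_inter (E p) ((S.erase p).biUnion E)
      have h3 : (E p ∩ (S.erase p).biUnion E).card ≤ 1 := by
        have key : ∀ x ∈ E p ∩ (S.erase p).biUnion E,
            ∃ v ∈ e p.2, π v = i ∧ x = amalgamEmb π i g p.1 v := by
          intro x hx
          simp only [hE, Finset.mem_inter, Finset.mem_biUnion, Finset.mem_image,
            Finset.mem_erase] at hx
          obtain ⟨⟨v, hv, rfl⟩, q, ⟨hqp, hq⟩, w, hw, hwv⟩ := hx
          refine ⟨v, hv, ?_, rfl⟩
          by_contra hvi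
          unfold amalgamEmb at hwv
          split_ifs at hwv
          exact hqp (hpu q hq (Prod.ext_iff.1 (Sum.inr.inj hwv)).1)
        rw [Finset.card_le_one]
        intro x hx y hy
        obtain ⟨v, hv, hvi, rfl⟩ := key x hx
        obtain ⟨w, hw, hwi, rfl⟩ := key y hy
        rw [hπ p.2 hv hw (hvi.trans hwi.symm)]
      have h4 := Finset.sum_erase_add S (fun s => (E s).card) hp
      have h5 := Finset.card_erase_add_one hp
      rw [hu]
      simp only [hE] at *
      omega
  · push Not at hA
    set T := S.image Prod.fst with hT
    set F : κ → Finset ι := fun h => (S.filter (fun p => p.1 = h)).image Prod.snd with hF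
    set U : κ → Finset V := fun h => (F h).biUnion e with hU
    set A : κ → Finset W := fun h => ((U h).filter (fun v => π v = i)).image (g h) with hAdef
    have memF : ∀ h s, s ∈ F h ↔ (h, s) ∈ S := by
      intro h s
      simp [hF]
    have cardF : ∀ h, (F h).card = (S.filter (fun p => p.1 = h)).card := by
      intro h
      apply Finset.card_image_of_injOn
      rintro ⟨a, b⟩ ha ⟨c, d⟩ hc hbd
      simp only [Finset.coe_filter, Set.mem_ofPred_eq] at ha hc
      exact Prod.ext (ha.2.trans hc.2.symm) hbd
    have hcardS : S.card = ∑ h ∈ T, (F h).card := by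
      rw [Finset.card_eq_sum_card_image Prod.fst S]
      exact Finset.sum_congr rfl fun h _ => (cardF h).symm
    have hTn : T.Nonempty := hS.image _
    have hF2 : ∀ h ∈ T, 2 ≤ (F h).card := by
      intro h hh
      obtain ⟨p, hp, rfl⟩ := Finset.mem_image.1 hh
      obtain ⟨q, hq, hqp, hne⟩ := hA p hp
      rw [cardF]
      exact Finset.one_lt_card.2 ⟨q, by simp [hq, hqp], p, by simp [hp], hne⟩
    have hTl : T.card ≤ l := by
      have := Finset.sum_le_sum hF2
      rw [← hcardS, Finset.sum_const, smul_eq_mul] at this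
      have := hTn.card_pos
      omega
    have hsumS : ∑ p ∈ S, ((e p.2).image (amalgamEmb π i g p.1)).card
        = ∑ h ∈ T, ∑ s ∈ F h, (e s).card := by
      have h0 : ∀ p ∈ S, p.1 ∈ T := fun p hp => Finset.mem_image_of_mem _ hp
      rw [← Finset.sum_fiberwise_of_maps_to h0]
      refine Finset.sum_congr rfl fun h _ => ?_
      rw [hF, Finset.sum_image]
      · exact Finset.sum_congr rfl fun p _ => Finset.card_image_of_injective _ (hinj _)
      · rintro ⟨a, b⟩ ha ⟨c, d⟩ hc hbd
        simp only [Finset.coe_filter, Set.mem_ofPred_eq] at ha hc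
        exact Prod.ext (ha.2.trans hc.2.symm) hbd
    have hP : ∑ h ∈ T, (∑ s ∈ F h, (e s).card + 1) ≤ ∑ h ∈ T, ((U h).card + (F h).card) := by
      refine Finset.sum_le_sum fun h hh => he (F h) ?_ ?_
      · exact Finset.card_pos.1 (by have := hF2 h hh; omega)
      · rw [cardF]
        exact (Finset.card_le_card (Finset.filter_subset _ _)).trans hl
    have hH := hf.of_subset hTn hTl (A := A) (by
      intro h _ w hw
      simp only [hAdef, Finset.mem_image, Finset.mem_filter] at hw
      obtain ⟨v, ⟨_, hv⟩, rfl⟩ := hw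
      exact hgf h v hv)
    have hUc : ∑ h ∈ T, (U h).card
        = ∑ h ∈ T, (A h).card + ∑ h ∈ T, ((U h).filter (fun v => ¬ π v = i)).card := by
      rw [← Finset.sum_add_distrib]
      refine Finset.sum_congr rfl fun h _ => ?_
      rw [← Finset.card_filter_add_card_filter_not (s := U h) (fun v => π v = i)]
      congr 1
      refine (Finset.card_image_of_injOn ?_).symm
      exact (hg h).mono (by intro v hv; simpa using (Finset.mem_filter.1 hv).2)
    have hunion : (T.biUnion A).card + ∑ h ∈ T, ((U h).filter (fun v => ¬ π v = i)).card
        ≤ (S.biUnion fun p => (e p.2).image (amalgamEmb π i g p.1)).card := by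
      have : ∑ h ∈ T, ((U h).filter (fun v => ¬ π v = i)).card
          = (T.sigma fun h => (U h).filter (fun v => ¬ π v = i)).card :=
        (Finset.card_sigma _ _).symm
      rw [this, ← Finset.card_disjSum]
      refine Finset.card_le_card_of_injOn
        (Sum.map id (fun x => (x.1, x.2))) ?_ ?_
      · rintro (w | ⟨h, v⟩) hx
        · simp only [Finset.mem_coe, Finset.inl_mem_disjSum, Finset.mem_biUnion, hAdef, hU,
            Finset.mem_image, Finset.mem_filter, memF] at hx
          obtain ⟨h, _, v, ⟨⟨s, hs, hvs⟩, hvi⟩, rfl⟩ := hx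
          simp only [Finset.mem_coe, Finset.mem_biUnion, Finset.mem_image]
          exact ⟨(h, s), hs, v, hvs, by simp [amalgamEmb, hvi]⟩
        · simp only [Finset.mem_coe, Finset.inr_mem_disjSum, Finset.mem_sigma, hU,
            Finset.mem_biUnion, Finset.mem_filter, memF] at hx
          obtain ⟨_, ⟨s, hs, hvs⟩, hvi⟩ := hx
          simp only [Finset.mem_coe, Finset.mem_biUnion, Finset.mem_image]
          exact ⟨(h, s), hs, v, hvs, by simp [amalgamEmb, hvi]⟩
      · refine Function.Injective.injOn (Sum.map_injective.2 ⟨Function.injective_id, ?_⟩)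
        rintro ⟨a, b⟩ ⟨c, d⟩ h
        simpa using h
    simp only [Finset.sum_add_distrib, Finset.sum_const, smul_eq_mul, mul_one] at hP
    rw [← hcardS] at hP
    rw [hsumS]
    omega

/-- Every coloring of the ground set with `k` colors has a monochromatic member. -/
def MonoForcing {ι V : Type*} (k : ℕ) (e : ι → Finset V) : Prop :=
  ∀ c : V → Fin k, ∃ s q, ∀ v ∈ e s, c v = q

/-- There are `r`-uniform hypergraphs of arbitrarily large girth and chromatic number. -/
theorem exists_sparse_monoForcing (k : ℕ) (hk : 0 < k) (l : ℕ) : ∀ r : ℕ,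
    ∃ (V ι : Type) (_ : Fintype V) (_ : Fintype ι) (_ : DecidableEq V) (_ : DecidableEq ι)
      (e : ι → Finset V), (∀ s, (e s).card = r) ∧ SparseFamily l e ∧ MonoForcing k e := by
  induction l with
  | zero =>
    intro r
    refine ⟨Fin (k * r), {s : Finset (Fin (k * r)) // s.card = r}, inferInstance, inferInstance,
      inferInstance, inferInstance, fun s => s.1, fun s => s.2, ?_, ?_⟩
    · intro S hS hl
      have := hS.card_pos
      omega
    · intro c
      have : Nonempty (Fin k) := ⟨⟨0, hk⟩⟩
      obtain ⟨q, _, hq⟩ := Finset.exists_le_card_fiber_of_mul_le_card_of_maps_to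
        (s := (Finset.univ : Finset (Fin (k * r)))) (t := (Finset.univ : Finset (Fin k)))
        (f := c) (n := r) (fun _ _ => Finset.mem_univ _) Finset.univ_nonempty (by simp)
      obtain ⟨s, hs, hsr⟩ := Finset.exists_subset_card_eq hq
      exact ⟨⟨s, hsr⟩, q, fun v hv => (Finset.mem_filter.1 (hs hv)).2⟩
  | succ l ih =>
    intro r
    obtain ⟨Q, κ₀, _, _, _, _, e₀, hr₀, -, hm₀⟩ := ih r
    have partite : ∀ J : Finset Q,
        ∃ (V ι : Type) (_ : Fintype V) (_ : Fintype ι) (_ : DecidableEq V) (_ : DecidableEq ι)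
          (e : ι → Finset V) (π : V → Q), (∀ s, (e s).card = r) ∧ (∀ s, Set.InjOn π (e s)) ∧
          SparseFamily (l + 1) e ∧ ∀ c : V → Fin k,
            (∀ v w, π v ∉ J → π v = π w → c v = c w) → ∃ s q, ∀ v ∈ e s, c v = q := by
      intro J
      induction J using Finset.induction_on with
      | empty =>
        have hinj : ∀ s : κ₀, Function.Injective (fun j : Q => (s, j)) :=
          fun s a b h => (Prod.ext_iff.1 h).2
        refine ⟨κ₀ × Q, κ₀, inferInstance, inferInstance, inferInstance, inferInstance,
          fun s => (e₀ s).map ⟨fun j => (s, j), hinj s⟩, Prod.snd, ?_, ?_, ?_, ?_⟩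
        · simpa using hr₀
        · intro s x hx y hy hxy
          simp only [Finset.coe_map, Function.Embedding.coeFn_mk, Set.mem_image] at hx hy
          obtain ⟨a, _, rfl⟩ := hx
          obtain ⟨b, _, rfl⟩ := hy
          exact Prod.ext rfl hxy
        · intro S hS _
          rw [Finset.card_biUnion]
          · exact Nat.add_le_add_left hS.card_pos _
          · intro s _ t _ hst
            rw [Function.onFun, Finset.disjoint_left]
            intro x hx hy
            simp only [Finset.mem_map, Function.Embedding.coeFn_mk] at hx hy
            obtain ⟨a, _, rfl⟩ := hx
            obtain ⟨b, _, hb⟩ := hy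
            exact hst (Prod.ext_iff.1 hb).1.symm
        · intro c hc
          obtain ⟨s₀, -⟩ := hm₀ (fun _ => ⟨0, hk⟩)
          obtain ⟨s, q, h⟩ := hm₀ (fun j => c (s₀, j))
          refine ⟨s, q, ?_⟩
          intro v hv
          simp only [Finset.mem_map, Function.Embedding.coeFn_mk] at hv
          obtain ⟨a, ha, rfl⟩ := hv
          rw [← h a ha]
          exact hc _ _ (Finset.notMem_empty _) rfl
      | insert i J _ ihJ =>
        obtain ⟨V, ι, _, _, _, _, e, π, hr, hπ, hs, hm⟩ := ihJ
        obtain ⟨W, κ, _, _, _, _, f, hfr, hfs, hfm⟩ :=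
          ih (Finset.univ.filter (fun v => π v = i)).card
        set X := Finset.univ.filter (fun v => π v = i) with hX
        rcases X.eq_empty_or_nonempty with h0 | ⟨v₀, hv₀⟩
        · refine ⟨V, ι, inferInstance, inferInstance, inferInstance, inferInstance,
            e, π, hr, hπ, hs, fun c hc => hm c fun v w hv => hc v w ?_⟩
          have : v ∉ X := by simp [h0]
          simp only [hX, Finset.mem_filter, Finset.mem_univ, true_and] at this
          simp [this, hv]
        have hbij : ∀ h : κ, ∃ g : V → W, Set.InjOn g {v | π v = i} ∧
            ∀ v, π v = i → g v ∈ f h := by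
          intro h
          let E := Finset.equivOfCardEq (hfr h).symm
          have hmem : ∀ v, v ∈ X ↔ π v = i := by simp [hX]
          refine ⟨fun v => if hv : v ∈ X then E ⟨v, hv⟩ else E ⟨v₀, hv₀⟩, ?_, ?_⟩
          · intro v hv w hw hvw
            have hv' : v ∈ X := (hmem v).2 hv
            have hw' : w ∈ X := (hmem w).2 hw
            simp only [hv', hw', dif_pos] at hvw
            simpa using E.injective (Subtype.ext hvw)
          · intro v hv
            simp [(hmem v).2 hv]
        choose g hgi hgm using hbij
        have hπφ : ∀ h v, Sum.elim (fun _ => i) (fun p : κ × V => π p.2) (amalgamEmb π i g h v)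
            = π v := by
          intro h v
          unfold amalgamEmb
          split_ifs with hv
          · exact hv.symm
          · rfl
        refine ⟨W ⊕ (κ × V), κ × ι, inferInstance, inferInstance, inferInstance, inferInstance,
          fun p => (e p.2).image (amalgamEmb π i g p.1),
          Sum.elim (fun _ => i) (fun p => π p.2), ?_, ?_, ?_, ?_⟩
        · intro s
          rw [Finset.card_image_of_injective _ (amalgamEmb_injective hgi _), hr]
        · rintro ⟨h, s⟩ x hx y hy hxy
          simp only [Finset.coe_image, Set.mem_image] at hx hy
          obtain ⟨v, hv, rfl⟩ := hx
          obtain ⟨w, hw, rfl⟩ := hy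
          rw [hπφ, hπφ] at hxy
          rw [hπ s hv hw hxy]
        · exact SparseFamily.amalgam hgi hgm hπ hs hfs
        · intro c hc
          obtain ⟨h, q, hq⟩ := hfm (fun w => c (Sum.inl w))
          obtain ⟨s, q', hs'⟩ := hm (fun v => c (amalgamEmb π i g h v)) (by
            intro v w hv hvw
            by_cases hvi : π v = i
            · have hwi : π w = i := hvw ▸ hvi
              simp only [amalgamEmb, hvi, hwi, if_true]
              rw [hq _ (hgm h v hvi), hq _ (hgm h w hwi)]
            · apply hc
              · rw [hπφ]
                simp [hvi, hv]
              · rw [hπφ, hπφ, hvw])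
          refine ⟨(h, s), q', ?_⟩
          intro x hx
          obtain ⟨v, hv, rfl⟩ := Finset.mem_image.1 hx
          exact hs' v hv
    obtain ⟨V, ι, i1, i2, i3, i4, e, π, hr, -, hs, hm⟩ := partite Finset.univ
    exact ⟨V, ι, i1, i2, i3, i4, e, hr, hs, fun c => hm c fun v _ hv =>
      (hv (Finset.mem_univ _)).elim⟩

/-- A 2-connected graph whose edges are covered by a sparse family is contained in one member. -/
theorem TwoConnected.subset_of_sparse {α ι V : Type*} [Fintype α] [DecidableEq V]
    {F : SimpleGraph α} (hF : TwoConnected F) {e : ι → Finset V}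
    (he : SparseFamily (Fintype.card α * Fintype.card α) e) {f : α → V}
    (hf : Function.Injective f) (hcov : ∀ u v, F.Adj u v → ∃ s, f u ∈ e s ∧ f v ∈ e s) :
    ∃ s, ∀ u, f u ∈ e s := by
  classical
  obtain ⟨h3, hconn, h2⟩ := hF
  by_contra! hno
  have : Nontrivial α := Fintype.one_lt_card_iff_nontrivial.1 (by omega)
  obtain ⟨u₀⟩ := hconn.nonempty
  obtain ⟨v₀, hv₀⟩ := hconn.preconnected.exists_adj_of_nontrivial u₀
  have : Nonempty ι := (hcov _ _ hv₀).nonempty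
  choose! t ht using hcov
  set S : Finset ι := (Finset.univ.filter (fun p : α × α => F.Adj p.1 p.2)).image
    (fun p => t p.1 p.2) with hS
  have htS : ∀ u v, F.Adj u v → t u v ∈ S := fun u v h =>
    Finset.mem_image.2 ⟨(u, v), by simpa using h, rfl⟩
  have hScard : S.card ≤ Fintype.card α * Fintype.card α := by
    rw [← Fintype.card_prod]
    exact Finset.card_image_le.trans (Finset.card_le_univ _)
  have hSne : S.Nonempty := by
    exact ⟨_, htS _ _ hv₀⟩
  set A : ι → Finset α := fun s => Finset.univ.filter (fun u => f u ∈ e s) with hA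
  have memA : ∀ s u, u ∈ A s ↔ f u ∈ e s := by simp [hA]
  have hsp : ∑ s ∈ S, (A s).card + 1 ≤ (S.biUnion A).card + S.card := by
    have := he.of_subset hSne hScard (A := fun s => (A s).image f) (by
      intro s _ v hv
      obtain ⟨u, hu, rfl⟩ := Finset.mem_image.1 hv
      exact (memA s u).1 hu)
    rw [← Finset.biUnion_image, Finset.card_image_of_injective _ hf] at this
    simpa only [Finset.card_image_of_injective _ hf] using this
  set d : α → ℕ := fun u => (S.filter (fun s => u ∈ A s)).card with hd
  set D : Finset α := Finset.univ.filter (fun u => 2 ≤ d u) with hD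
  have hatt : ∀ s ∈ S, 2 ≤ (A s ∩ D).card := by
    intro s hs
    by_contra! hlt
    obtain ⟨⟨p, q⟩, hpq, rfl⟩ := Finset.mem_image.1 hs
    simp only [Finset.mem_filter, Finset.mem_univ, true_and] at hpq
    set s := t p q
    have hp : p ∈ A s := (memA _ _).2 (ht p q hpq).1
    have hq : q ∈ A s := (memA _ _).2 (ht p q hpq).2
    obtain ⟨w, hw, hwD⟩ : ∃ w ∈ A s, A s ∩ D ⊆ {w} := by
      rcases (A s ∩ D).eq_empty_or_nonempty with h0 | ⟨w, hw⟩
      · exact ⟨p, hp, by simp [h0]⟩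
      · refine ⟨w, (Finset.mem_inter.1 hw).1, fun x hx => ?_⟩
        exact Finset.mem_singleton.2 (Finset.card_le_one.1 (by omega) x hx w hw)
    obtain ⟨u, hu, huw⟩ : ∃ u ∈ A s, u ≠ w := by
      by_cases h : p = w
      · exact ⟨q, hq, fun h' => hpq.ne (h.trans h'.symm)⟩
      · exact ⟨p, hp, h⟩
    obtain ⟨z, hz⟩ := hno s
    have hzA : z ∉ A s := fun h => hz ((memA _ _).1 h)
    have hzw : z ≠ w := fun h => hzA (h ▸ hw)
    obtain ⟨W⟩ := (h2 w).preconnected ⟨u, huw⟩ ⟨z, hzw⟩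
    obtain ⟨b, -, hb1, hb2⟩ := W.exists_boundary_dart {x | x.1 ∈ A s} hu hzA
    have hadj : F.Adj b.fst.1 b.snd.1 := b.adj
    have hb1' : b.fst.1 ∈ A s := hb1
    have hb2' : b.snd.1 ∉ A s := hb2
    have hne : t b.fst.1 b.snd.1 ≠ s := by
      intro h
      exact hb2' ((memA _ _).2 (h ▸ (ht _ _ hadj).2))
    have hbD : b.fst.1 ∈ D := by
      simp only [hD, Finset.mem_filter, Finset.mem_univ, true_and, hd]
      refine Finset.one_lt_card.2 ⟨_, ?_, s, ?_, hne⟩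
      · exact Finset.mem_filter.2 ⟨htS _ _ hadj, (memA _ _).2 (ht _ _ hadj).1⟩
      · exact Finset.mem_filter.2 ⟨hs, hb1'⟩
    exact b.fst.2 (Finset.mem_singleton.1 (hwD (Finset.mem_inter.2 ⟨hb1', hbD⟩)))
  have hsum : ∑ s ∈ S, (A s).card = ∑ u, d u := by
    have := Finset.sum_card_bipartiteAbove_eq_sum_card_bipartiteBelow
      (s := S) (t := (Finset.univ : Finset α)) (fun s u => u ∈ A s)
    simpa [Finset.bipartiteAbove, Finset.bipartiteBelow] using this
  have hsumD : ∑ s ∈ S, (A s ∩ D).card = ∑ u, if 2 ≤ d u then d u else 0 := by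
    have := Finset.sum_card_bipartiteAbove_eq_sum_card_bipartiteBelow
      (s := S) (t := D) (fun s u => u ∈ A s)
    rw [← Finset.sum_filter]
    refine Eq.trans (Finset.sum_congr rfl fun s _ => ?_) this
    congr 1
    ext u
    simp [Finset.bipartiteAbove, and_comm]
  have hun : (S.biUnion A).card = ∑ u, if 1 ≤ d u then 1 else 0 := by
    rw [← Finset.sum_filter, ← Finset.card_eq_sum_ones]
    congr 1
    ext u
    simp only [Finset.mem_biUnion, Finset.mem_filter, Finset.mem_univ, true_and, hd,
      Nat.one_le_iff_ne_zero, ← Nat.pos_iff_ne_zero, Finset.card_pos]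
    exact ⟨fun ⟨s, h⟩ => ⟨s, Finset.mem_filter.2 h⟩, fun ⟨s, h⟩ => ⟨s, Finset.mem_filter.1 h⟩⟩
  have hpt : ∑ u, ((if 2 ≤ d u then d u else 0) + 2 * if 1 ≤ d u then 1 else 0)
      ≤ ∑ u, 2 * d u := by
    refine Finset.sum_le_sum fun u _ => ?_
    split_ifs <;> omega
  rw [Finset.sum_add_distrib, ← Finset.mul_sum, ← Finset.mul_sum, ← hsumD, ← hun, ← hsum] at hpt
  have := Finset.sum_le_sum hatt
  rw [Finset.sum_const, smul_eq_mul] at this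
  omega

/-- `G` contains no subgraph isomorphic to `F`. -/
def NoCopy {α β : Type*} (F : SimpleGraph α) (G : SimpleGraph β) : Prop :=
  ∀ f : F →g G, ¬ Function.Injective f

/-- A Folkman-type theorem for vertex colorings: for a graph `A` with fewer vertices than the
2-connected graph `F`, there is an `F`-free graph in which every vertex coloring with at most `k`
colors has a monochromatic copy of `A`. -/
theorem TwoConnected.exists_noCopy_mono {α γ : Type*} [Fintype α] [Fintype γ]
    {F : SimpleGraph α} (hF : TwoConnected F) (A : SimpleGraph γ)
    (hA : Fintype.card γ < Fintype.card α) {k : ℕ} (hk : 0 < k) :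
    ∃ (V : Type) (_ : Fintype V) (B : SimpleGraph V), NoCopy F B ∧
      ∀ c : V → ℕ, (Set.range c).ncard ≤ k →
        ∃ (g : A →g B) (q : ℕ), Function.Injective g ∧ ∀ x, c (g x) = q := by
  obtain ⟨V, ι, _, _, _, _, e, hr, hs, hm⟩ := exists_sparse_monoForcing k hk
    (Fintype.card α * Fintype.card α) (Fintype.card γ)
  let E : ∀ s, γ ≃ e s := fun s => Fintype.equivOfCardEq (by simp [hr])
  let B : SimpleGraph V := SimpleGraph.mk
    (fun v w => ∃ s a b, A.Adj a b ∧ (E s a : V) = v ∧ (E s b : V) = w)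
    (by
      constructor
      rintro v w ⟨s, a, b, h, ha, hb⟩
      exact ⟨s, b, a, h.symm, hb, ha⟩)
    (by
      constructor
      rintro v ⟨s, a, b, h, ha, hb⟩
      exact h.ne ((E s).injective (Subtype.ext (ha.trans hb.symm))))
  refine ⟨V, inferInstance, B, ?_, ?_⟩
  · intro f hf
    obtain ⟨s, hs⟩ := hF.subset_of_sparse hs hf (by
      intro u v huv
      obtain ⟨s, a, b, -, ha, hb⟩ := f.map_rel huv
      exact ⟨s, ha ▸ (E s a).2, hb ▸ (E s b).2⟩)
    have := Finset.card_le_card_of_injOn (s := Finset.univ) f (fun u _ => hs u) hf.injOn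
    rw [hr, Finset.card_univ] at this
    omega
  · intro c hc
    have : Fintype (Set.range c) := Fintype.ofFinite _
    obtain ⟨φ⟩ : Nonempty (Set.range c ↪ Fin k) := by
      rw [Function.Embedding.nonempty_iff_card_le, Fintype.card_fin, ← Nat.card_eq_fintype_card]
      exact hc
    obtain ⟨s, q, hq⟩ := hm (fun v => φ ⟨c v, v, rfl⟩)
    by_cases hγ : Nonempty γ
    · obtain ⟨a⟩ := hγ
      refine ⟨⟨fun x => E s x, fun {x y} h => ⟨s, x, y, h, rfl, rfl⟩⟩, c (E s a), ?_, ?_⟩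
      · exact fun x y h => (E s).injective (Subtype.ext h)
      · intro x
        have := φ.injective ((hq _ (E s x).2).trans (hq _ (E s a).2).symm)
        exact Subtype.ext_iff.1 this
    · exact ⟨⟨fun x => (hγ ⟨x⟩).elim, fun {x} => (hγ ⟨x⟩).elim⟩, 0,
        fun x => (hγ ⟨x⟩).elim, fun x => (hγ ⟨x⟩).elim⟩

/-- There is an `F`-free graph of chromatic number exactly `k`. -/
theorem TwoConnected.exists_noCopy_colorable {α : Type*} [Fintype α] {F : SimpleGraph α}
    (hF : TwoConnected F) {k : ℕ} (hk : 0 < k) :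
    ∃ (V : Type) (_ : Fintype V) (H : SimpleGraph V), NoCopy F H ∧ H.Colorable k ∧
      ¬ H.Colorable (k - 1) := by
  classical
  obtain ⟨V, _, B, hB, hm⟩ := hF.exists_noCopy_mono (⊤ : SimpleGraph (Fin 2))
    (by rw [Fintype.card_fin]; exact hF.1) hk
  have hBk : ¬ B.Colorable k := by
    rintro ⟨C⟩
    obtain ⟨g, q, -, hg⟩ := hm (fun v => (C v : ℕ)) (by
      have : Set.range (fun v => (C v : ℕ)) ⊆ (Finset.range k : Set ℕ) := by
        rintro _ ⟨v, rfl⟩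
        simp
      simpa using Set.ncard_le_ncard this (Finset.finite_toSet _))
    exact C.valid (g.map_rel (show (⊤ : SimpleGraph (Fin 2)).Adj 0 1 by simp))
      (Fin.ext ((hg 0).trans (hg 1).symm))
  obtain ⟨H, hH⟩ : ∃ H, Maximal (fun H : SimpleGraph V => H ≤ B ∧ H.Colorable k) H := by
    refine (Set.toFinite {H : SimpleGraph V | H ≤ B ∧ H.Colorable k}).exists_maximal
      ⟨⊥, bot_le, ?_⟩
    exact ⟨SimpleGraph.Coloring.mk (fun _ => ⟨0, hk⟩) (by simp)⟩
  refine ⟨V, inferInstance, H, ?_, hH.prop.2, ?_⟩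
  · intro f hf
    exact hB ((SimpleGraph.Hom.ofLE hH.prop.1).comp f) hf
  · rintro ⟨C⟩
    obtain ⟨u, v, huv, hnot⟩ : ∃ u v, B.Adj u v ∧ ¬ H.Adj u v := by
      by_contra! h
      exact hBk (hH.prop.2.mono_left fun u v huv => h u v huv)
    have hle : H ⊔ SimpleGraph.edge u v ≤ B :=
      sup_le hH.prop.1 ((SimpleGraph.edge_le_iff _).2 (Or.inr huv))
    refine hnot (hH.le_of_ge ⟨hle, ?_⟩ le_sup_left
      (Or.inr ((SimpleGraph.edge_adj _ _ _ _).2 ⟨Or.inl ⟨rfl, rfl⟩, huv.ne⟩)))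
    refine ⟨SimpleGraph.Coloring.mk
      (fun x => if x = u then ⟨k - 1, by omega⟩ else ⟨C x, by have := (C x).2; omega⟩) ?_⟩
    intro x y hxy h
    have hx := (C x).2
    have hy := (C y).2
    have hne := hxy.ne
    split_ifs at h with h1 h2 h2
    · exact hne (h1.trans h2.symm)
    · simp only [Fin.mk.injEq] at h
      omega
    · simp only [Fin.mk.injEq] at h
      omega
    · rcases hxy with hxy | hxy
      · exact C.valid hxy (Fin.ext (Fin.mk.inj h))
      · rcases ((SimpleGraph.edge_adj _ _ _ _).1 hxy).1 with ⟨rfl, rfl⟩ | ⟨rfl, rfl⟩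
        · exact h1 rfl
        · exact h2 rfl

/-- The lexicographic product: every vertex of `H` is replaced by a copy of `B`. -/
def lexGraph {V W : Type*} (H : SimpleGraph V) (B : SimpleGraph W) : SimpleGraph (V × W) where
  Adj x y := H.Adj x.1 y.1 ∨ x.1 = y.1 ∧ B.Adj x.2 y.2
  symm := by
    constructor
    rintro x y (h | ⟨h, h'⟩)
    · exact Or.inl h.symm
    · exact Or.inr ⟨h.symm, h'.symm⟩
  loopless := by
    constructor
    rintro x (h | ⟨_, h⟩)
    · exact h.ne rfl
    · exact h.ne rfl

theorem isFWORM_lexGraph {α V W : Type*} {F : SimpleGraph α} (hF : F.Connected)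
    {H : SimpleGraph V} {B : SimpleGraph W} (hH : NoCopy F H) (hB : NoCopy F B) {c : V → ℕ}
    (hc : ∀ u v, H.Adj u v → c u ≠ c v) : IsFWORM F (lexGraph H B) (fun x => c x.1) := by
  intro f hf
  constructor
  · by_contra! h
    have key : ∀ u v, F.Adj u v → (f u).1 = (f v).1 ∧ B.Adj (f u).2 (f v).2 := fun u v huv =>
      (f.map_rel huv).resolve_left fun hadj => hc _ _ hadj (h u v)
    have hconst : ∀ u v, (f u).1 = (f v).1 := by
      intro u v
      obtain ⟨w⟩ := hF.preconnected u v
      induction w with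
      | nil => rfl
      | cons hadj _ ih => exact (key _ _ hadj).1.trans ih
    exact hB ⟨fun u => (f u).2, fun {u v} huv => (key u v huv).2⟩
      fun u v huv => hf (Prod.ext (hconst u v) huv)
  · by_contra! h
    refine hH ⟨fun u => (f u).1, fun {u v} huv => (f.map_rel huv).resolve_right fun hadj =>
      h u v huv.ne (congrArg c hadj.1)⟩ fun u v huv => ?_
    by_contra hne
    exact h u v hne (congrArg c huv)

theorem le_ncard_range_of_isFWORM_lexGraph {α V W : Type*} [Finite V] [Finite W]
    {F : SimpleGraph α} {x₀ : α} {k : ℕ} {H : SimpleGraph V} {B : SimpleGraph W}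
    (hH : ¬ H.Colorable (k - 1))
    (hB : ∀ c : W → ℕ, (Set.range c).ncard ≤ k →
      ∃ (g : F.induce {x₀}ᶜ →g B) (q : ℕ), Function.Injective g ∧ ∀ x, c (g x) = q)
    (hne : ∃ x, x ≠ x₀)
    {c : V × W → ℕ} (hc : IsFWORM F (lexGraph H B) c) : k ≤ (Set.range c).ncard := by
  classical
  by_contra! hlt
  have hB' : ∀ v : V, ∃ (g : F.induce {x₀}ᶜ →g B) (q : ℕ),
      Function.Injective g ∧ ∀ x, c (v, g x) = q := fun v =>
    hB (fun w => c (v, w)) ((Set.ncard_le_ncard (by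
      rintro _ ⟨w, rfl⟩
      exact ⟨_, rfl⟩) (Set.toFinite _)).trans hlt.le)
  choose g q hg hq using hB'
  obtain ⟨y, hy⟩ := hne
  have hproper : ∀ u v, H.Adj u v → q u ≠ q v := by
    intro u v huv huq
    let φ : α → V × W := fun x => if hx : x = x₀ then (v, g v ⟨y, hy⟩) else (u, g u ⟨x, hx⟩)
    have hφ : ∀ x, c (φ x) = q u := by
      intro x
      by_cases hx : x = x₀
      · simp only [φ, hx, dif_pos, hq, huq]
      · simp only [φ, hx, dif_neg, not_false_eq_true, hq]
    have hhom : ∀ {a b}, F.Adj a b → (lexGraph H B).Adj (φ a) (φ b) := by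
      intro a b hab
      by_cases ha : a = x₀ <;> by_cases hb : b = x₀
      · exact (hab.ne (ha.trans hb.symm)).elim
      · simp only [φ, ha, hb, dif_pos, dif_neg, not_false_eq_true]
        exact Or.inl huv.symm
      · simp only [φ, ha, hb, dif_pos, dif_neg, not_false_eq_true]
        exact Or.inl huv
      · simp only [φ, ha, hb, dif_neg, not_false_eq_true]
        exact Or.inr ⟨rfl, (g u).map_rel (a := ⟨a, ha⟩) (b := ⟨b, hb⟩) hab⟩
    have hinj : Function.Injective φ := by
      intro a b hab
      by_cases ha : a = x₀ <;> by_cases hb : b = x₀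
      · exact ha.trans hb.symm
      · simp only [φ, ha, hb, dif_pos, dif_neg, not_false_eq_true, Prod.mk.injEq] at hab
        exact (huv.ne hab.1.symm).elim
      · simp only [φ, ha, hb, dif_pos, dif_neg, not_false_eq_true, Prod.mk.injEq] at hab
        exact (huv.ne hab.1).elim
      · simp only [φ, ha, hb, dif_neg, not_false_eq_true, Prod.mk.injEq, true_and] at hab
        exact Subtype.ext_iff.1 (hg u hab)
    obtain ⟨⟨a, b, hab⟩, -⟩ := hc ⟨φ, hhom⟩ hinj
    exact hab ((hφ a).trans (hφ b).symm)
  have : Fintype (Set.range c) := Fintype.ofFinite _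
  let C : H.Coloring (Set.range c) := SimpleGraph.Coloring.mk
    (fun v => ⟨q v, (v, g v ⟨y, hy⟩), hq v _⟩)
    (fun {u v} huv h => hproper u v huv (Subtype.ext_iff.1 h))
  refine hH (C.colorable.mono ?_)
  have : Fintype.card (Set.range c) = (Set.range c).ncard := by
    rw [← Nat.card_eq_fintype_card]
    rfl
  omega

theorem IsFWORM.comp_equiv {α β β' : Type*} {F : SimpleGraph α} {G : SimpleGraph β} {c : β → ℕ}
    (hc : IsFWORM F G c) (e : β' ≃ β) : IsFWORM F (G.comap e) (c ∘ e) := fun f hf =>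
  hc ⟨fun u => e (f u), fun {_ _} h => f.map_rel h⟩ (e.injective.comp hf)

/-- For every 2-connected graph `F` and every positive integer `k`, there is an
`F`-WORM colorable graph `G` with `W^-(G,F) = k`. -/
theorem stmt7 {α : Type} [Fintype α] (F : SimpleGraph α) (hF : TwoConnected F)
    (k : ℕ) (hk : 1 ≤ k) :
    ∃ (m : ℕ) (G : SimpleGraph (Fin m)), FWORMColorable F G ∧ wormLower F G = k := by
  classical
  obtain ⟨x₀⟩ := hF.2.1.nonempty
  obtain ⟨y, hy⟩ : ∃ y, y ≠ x₀ := by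
    have : Nontrivial α := Fintype.one_lt_card_iff_nontrivial.1 (by have := hF.1; omega)
    exact exists_ne x₀
  obtain ⟨V, _, H, hHF, ⟨C⟩, hH⟩ := hF.exists_noCopy_colorable hk
  obtain ⟨W, _, B, hBF, hB⟩ := hF.exists_noCopy_mono (F.induce {x₀}ᶜ)
    (Fintype.card_subtype_lt (x := x₀) (by simp)) hk
  let e : Fin (Fintype.card (V × W)) ≃ V × W := (Fintype.equivFin _).symm
  have hlow : ∀ c, IsFWORM F ((lexGraph H B).comap e) c → k ≤ (Set.range c).ncard := by
    intro c hc
    have h : IsFWORM F (lexGraph H B) (c ∘ e.symm) := by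
      have := hc.comp_equiv e.symm
      rwa [SimpleGraph.comap_comap, e.self_comp_symm, SimpleGraph.comap_id] at this
    have := le_ncard_range_of_isFWORM_lexGraph hH hB ⟨y, hy⟩ h
    rwa [e.symm.surjective.range_comp] at this
  have hc := (isFWORM_lexGraph hF.2.1 hHF hBF (c := fun v => (C v : ℕ))
    fun u v huv h => C.valid huv (Fin.ext h)).comp_equiv e
  refine ⟨_, (lexGraph H B).comap e, ⟨_, hc⟩, IsLeast.csInf_eq ⟨⟨_, hc, ?_⟩, ?_⟩⟩
  · refine le_antisymm ?_ (hlow _ hc)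
    refine (Set.ncard_le_ncard (t := (Finset.range k : Set ℕ)) ?_ (Finset.finite_toSet _)).trans
      (by simp)
    rintro _ ⟨v, rfl⟩
    simp
  · rintro _ ⟨c, hc', rfl⟩
    exact hlow c hc'
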